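/- (Likelihood second-moment expansion for the de-biasing direction in Gaussian graphical models.) Let x₁,…,x_n be i.i.d. N(0, Θ₀⁻¹) in R^p, p_Θ the joint density, Σ̂ = (1/n)Σᵢ xᵢxᵢᵀ, and let U be symmetric with Θ₀ + U and Θ₀ + 2U positive definite. Then E_{Θ₀}[(p_{Θ₀+U}(x)/p_{Θ₀}(x) - 1 - n·tr((Σ̂ - Σ₀)U))²] = (det(Θ₀+U))^n/(det Θ₀)^n · (det Θ₀/det(Θ₀+2U))^{n/2} - 1 + Σᵢ Var(xᵢᵀUxᵢ) - 2n·tr(((Θ₀+U)⁻¹ - Σ₀)U). -/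

import Mathlib

open Matrix MeasureTheory ProbabilityTheory Real

/-- The joint density of `n` i.i.d. `N(0, Θ⁻¹)` observations in `ℝ^p`:
`p_Θ(x₁,…,xₙ) = det(Θ)^{n/2}/(2π)^{np/2}·exp(-½Σᵢ xᵢᵀΘxᵢ)`. -/
noncomputable def ggmDensity (n p : ℕ) (T : Matrix (Fin p) (Fin p) ℝ)
    (x : Fin n → Fin p → ℝ) : ℝ :=
  T.det ^ ((n : ℝ) / 2) / (2 * Real.pi) ^ ((n * p : ℝ) / 2) *
    Real.exp (-(∑ i, x i ⬝ᵥ T.mulVec (x i)) / 2)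


theorem map_withDensity_comp {α β : Type*} [MeasurableSpace α] [MeasurableSpace β]
    (μ : Measure α) {f : α → β} (hf : Measurable f) {g : β → ENNReal} (hg : Measurable g) :
    (μ.withDensity (g ∘ f)).map f = (μ.map f).withDensity g := by
  ext s hs
  rw [Measure.map_apply hf hs, withDensity_apply _ (hf hs), withDensity_apply _ hs,
    setLIntegral_map hs hg hf]
  rfl

theorem pi_withDensity_ofReal {ι : Type*} [Fintype ι] {E : Type*} [MeasurableSpace E]
    (μ : ι → Measure E) [∀ i, SigmaFinite (μ i)] (f : ι → E → ℝ)
    (hf : ∀ i, Integrable (f i) (μ i)) (hf0 : ∀ i x, 0 ≤ f i x) :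
    Measure.pi (fun i => (μ i).withDensity fun x => ENNReal.ofReal (f i x)) =
      (Measure.pi μ).withDensity fun x => ENNReal.ofReal (∏ i, f i (x i)) := by
  have hfin : ∀ i, IsFiniteMeasure ((μ i).withDensity fun x => ENNReal.ofReal (f i x)) :=
    fun i => isFiniteMeasure_withDensity_ofReal (hf i).2
  refine Measure.pi_eq fun s hs => ?_
  have hi : ∀ i, Integrable ((s i).indicator (f i)) (μ i) := fun i => (hf i).indicator (hs i)
  rw [withDensity_apply _ (MeasurableSet.univ_pi hs),
    ← lintegral_indicator (MeasurableSet.univ_pi hs)]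
  have h1 : (Set.univ.pi s).indicator (fun x : ι → E => ENNReal.ofReal (∏ i, f i (x i))) =
      fun x => ENNReal.ofReal (∏ i, (s i).indicator (f i) (x i)) := by
    ext x
    by_cases hx : x ∈ Set.univ.pi s
    · rw [Set.indicator_of_mem hx]
      congr 1
      exact Finset.prod_congr rfl fun i _ => (Set.indicator_of_mem (hx i trivial) _).symm
    · rw [Set.indicator_of_notMem hx]
      simp only [Set.mem_pi, Set.mem_univ, true_imp_iff, not_forall] at hx
      obtain ⟨i, hi⟩ := hx
      rw [Finset.prod_eq_zero (Finset.mem_univ i) (Set.indicator_of_notMem hi _),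
        ENNReal.ofReal_zero]
  have hnn : ∀ i x, 0 ≤ (s i).indicator (f i) x := fun i x =>
    Set.indicator_nonneg (fun x _ => hf0 i x) x
  rw [h1, ← ofReal_integral_eq_lintegral_ofReal (Integrable.fintype_prod hi)
    (ae_of_all _ fun x => Finset.prod_nonneg fun i _ => hnn i _),
    integral_fintype_prod_eq_prod,
    ENNReal.ofReal_prod_of_nonneg fun i _ => integral_nonneg (hnn i)]
  refine Finset.prod_congr rfl fun i _ => ?_
  rw [withDensity_apply _ (hs i), integral_indicator (hs i),
    ofReal_integral_eq_lintegral_ofReal (hf i).integrableOn (ae_of_all _ (hf0 i))]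

/-- The centred Gaussian density on `ℝ^p` with precision matrix `M`. -/
noncomputable def gaussianPrecisionDensity {p : ℕ} (M : Matrix (Fin p) (Fin p) ℝ)
    (v : Fin p → ℝ) : ℝ :=
  M.det ^ ((1 : ℝ) / 2) / (2 * Real.pi) ^ ((p : ℝ) / 2) * Real.exp (-(v ⬝ᵥ M.mulVec v) / 2)

theorem measurable_gaussianPrecisionDensity {p : ℕ} (M : Matrix (Fin p) (Fin p) ℝ) :
    Measurable (gaussianPrecisionDensity M) := by
  have : Continuous (gaussianPrecisionDensity M) := by
    unfold gaussianPrecisionDensity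
    fun_prop
  exact this.measurable

theorem gaussianPrecisionDensity_nonneg {p : ℕ} {M : Matrix (Fin p) (Fin p) ℝ} (hM : M.PosDef)
    (v : Fin p → ℝ) : 0 ≤ gaussianPrecisionDensity M v := by
  have := hM.det_pos
  unfold gaussianPrecisionDensity
  positivity

theorem ggmDensity_eq_prod {n p : ℕ} {M : Matrix (Fin p) (Fin p) ℝ} (hM : M.PosDef)
    (x : Fin n → Fin p → ℝ) : ggmDensity n p M x = ∏ i, gaussianPrecisionDensity M (x i) := by
  unfold ggmDensity gaussianPrecisionDensity
  rw [Finset.prod_mul_distrib, Finset.prod_const, ← Real.exp_sum, div_pow, Finset.card_univ,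
    Fintype.card_fin, ← Real.rpow_mul_natCast hM.det_pos.le,
    ← Real.rpow_mul_natCast (by positivity), ← Finset.sum_div, Finset.sum_neg_distrib]
  congr 4 <;> ring

theorem exists_mul_transpose_eq_inv {p : ℕ} {M : Matrix (Fin p) (Fin p) ℝ} (hM : M.PosDef) :
    ∃ B : Matrix (Fin p) (Fin p) ℝ, B * Bᵀ = M⁻¹ := by
  open scoped MatrixOrder in
  obtain ⟨B, hB⟩ := CStarAlgebra.nonneg_iff_eq_mul_star_self.mp
    (Matrix.nonneg_iff_posSemidef.mpr hM.inv.posSemidef)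
  exact ⟨B, by rw [hB, Matrix.star_eq_conjTranspose, Matrix.conjTranspose_eq_transpose_of_trivial]⟩

section Factor

variable {p : ℕ} {M B : Matrix (Fin p) (Fin p) ℝ}

theorem isUnit_det_of_mul_transpose_eq_inv (hM : M.PosDef) (hB : B * Bᵀ = M⁻¹) :
    IsUnit B.det := by
  have h := congrArg Matrix.det hB
  rw [Matrix.det_mul] at h
  exact isUnit_of_mul_isUnit_left (h ▸ (Matrix.isUnit_nonsing_inv_det_iff.mpr
    hM.det_pos.ne'.isUnit))

theorem transpose_mul_mul_eq_one (hM : M.PosDef) (hB : B * Bᵀ = M⁻¹) : Bᵀ * M * B = 1 := by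
  have h1 : B * (Bᵀ * M) = 1 := by
    rw [← Matrix.mul_assoc, hB, Matrix.nonsing_inv_mul _ hM.det_pos.ne'.isUnit]
  exact mul_eq_one_comm.mp h1

theorem gaussianPrecisionDensity_mulVec (hM : M.PosDef) (hB : B * Bᵀ = M⁻¹) (z : Fin p → ℝ) :
    |B.det| * gaussianPrecisionDensity M (B.mulVec z) = ∏ i, gaussianPDFReal 0 1 (z i) := by
  have hq : B.mulVec z ⬝ᵥ M.mulVec (B.mulVec z) = ∑ i, z i ^ 2 := by
    rw [Matrix.dotProduct_mulVec, Matrix.vecMul_mulVec, ← Matrix.dotProduct_mulVec,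
      Matrix.mulVec_mulVec, transpose_mul_mul_eq_one hM hB, Matrix.one_mulVec]
    simp [dotProduct, sq]
  have hd : M.det ^ ((1 : ℝ) / 2) = |B.det|⁻¹ := by
    have h := congrArg Matrix.det (transpose_mul_mul_eq_one hM hB)
    rw [Matrix.det_mul, Matrix.det_mul, Matrix.det_transpose, Matrix.det_one] at h
    have h0 := (isUnit_det_of_mul_transpose_eq_inv hM hB).ne_zero
    have : M.det = (|B.det|⁻¹) ^ 2 := by
      rw [inv_pow, sq_abs]
      field_simp
      linarith
    rw [← Real.sqrt_eq_rpow, this, Real.sqrt_sq (by positivity)]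
  have h0 := abs_pos.mpr (isUnit_det_of_mul_transpose_eq_inv hM hB).ne_zero
  unfold gaussianPrecisionDensity gaussianPDFReal
  rw [hq, hd, Finset.prod_mul_distrib, Finset.prod_const, ← Real.exp_sum, Finset.card_univ,
    Fintype.card_fin]
  have hc : (2 * Real.pi) ^ ((p : ℝ) / 2) = √(2 * π) ^ p := by
    rw [Real.sqrt_eq_rpow, ← Real.rpow_mul_natCast (by positivity)]
    congr 1
    ring
  rw [hc]
  simp only [NNReal.coe_one, mul_one, sub_zero]
  rw [← Finset.sum_div, Finset.sum_neg_distrib, inv_pow]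
  field_simp

theorem map_mulVec_pi_gaussianReal (hM : M.PosDef) (hB : B * Bᵀ = M⁻¹) :
    (Measure.pi fun _ : Fin p => gaussianReal 0 1).map B.mulVec =
      volume.withDensity fun v => ENNReal.ofReal (gaussianPrecisionDensity M v) := by
  have hmeas : Measurable B.mulVec := by
    have : Continuous B.mulVec := by fun_prop
    exact this.measurable
  have hdet := (isUnit_det_of_mul_transpose_eq_inv hM hB).ne_zero
  have hg : Measurable fun v => ENNReal.ofReal (gaussianPrecisionDensity M v) :=
    (measurable_gaussianPrecisionDensity M).ennreal_ofReal
  have hpi : (Measure.pi fun _ : Fin p => gaussianReal 0 1) =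
      volume.withDensity fun z : Fin p → ℝ => ENNReal.ofReal (∏ i, gaussianPDFReal 0 1 (z i)) := by
    rw [volume_pi, ← pi_withDensity_ofReal _ _ (fun _ => integrable_gaussianPDFReal 0 1)
      (fun _ => gaussianPDFReal_nonneg 0 1)]
    simp only [gaussianReal_of_var_ne_zero 0 one_ne_zero]
    rfl
  have hvol := Real.map_matrix_volume_pi_eq_smul_volume_pi hdet
  have hcomp : (fun z : Fin p → ℝ => ENNReal.ofReal (∏ i, gaussianPDFReal 0 1 (z i))) =
      ENNReal.ofReal |B.det| •
        ((fun v => ENNReal.ofReal (gaussianPrecisionDensity M v)) ∘ B.mulVec) := by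
    ext z
    rw [← gaussianPrecisionDensity_mulVec hM hB, ENNReal.ofReal_mul (abs_nonneg _)]
    rfl
  rw [hpi, hcomp, withDensity_smul _ (hg.comp hmeas), Measure.map_smul,
    map_withDensity_comp _ hmeas hg]
  change ENNReal.ofReal |B.det| • (volume.map (toLin' B)).withDensity _ = _
  rw [hvol, withDensity_smul_measure, smul_smul, ← ENNReal.ofReal_mul (abs_nonneg _), ← abs_mul,
    mul_inv_cancel₀ hdet, abs_one, ENNReal.ofReal_one, one_smul]

end Factor

/-- The centred Gaussian measure on `ℝ^p` with precision matrix `M`. -/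
noncomputable def gaussianPrecision {p : ℕ} (M : Matrix (Fin p) (Fin p) ℝ) :
    Measure (Fin p → ℝ) :=
  volume.withDensity fun v => ENNReal.ofReal (gaussianPrecisionDensity M v)

theorem measurable_mulVec {p : ℕ} (B : Matrix (Fin p) (Fin p) ℝ) : Measurable B.mulVec := by
  have : Continuous B.mulVec := by fun_prop
  exact this.measurable

theorem isProbabilityMeasure_gaussianPrecision {p : ℕ} {M : Matrix (Fin p) (Fin p) ℝ}
    (hM : M.PosDef) : IsProbabilityMeasure (gaussianPrecision M) := by
  obtain ⟨B, hB⟩ := exists_mul_transpose_eq_inv hM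
  rw [gaussianPrecision, ← map_mulVec_pi_gaussianReal hM hB]
  exact Measure.isProbabilityMeasure_map (measurable_mulVec B).aemeasurable

theorem memLp_eval_mul_eval_pi_gaussianReal {ι : Type*} [Fintype ι] (j k : ι) :
    MemLp (fun z : ι → ℝ => z j * z k) 2 (Measure.pi fun _ => gaussianReal 0 1) := by
  have h : ∀ i : ι, MemLp (fun z : ι → ℝ => z i) 4 (Measure.pi fun _ => gaussianReal 0 1) :=
    fun i => (memLp_id_gaussianReal' 4 (by simp)).comp_measurePreserving
      (measurePreserving_eval (fun _ : ι => gaussianReal 0 1) i)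
  have : ENNReal.HolderTriple 4 4 2 := by
    constructor
    rw [← ENNReal.toReal_eq_toReal_iff' (by simp) (by simp),
      ENNReal.toReal_add (by simp) (by simp)]
    norm_num
  exact (h k).mul' (h j)

theorem integral_eval_mul_eval_pi_gaussianReal {ι : Type*} [Fintype ι] [DecidableEq ι] (j k : ι) :
    ∫ z : ι → ℝ, z j * z k ∂(Measure.pi fun _ => gaussianReal 0 1) = if j = k then 1 else 0 := by
  have heval : ∀ i : ι, ∫ z : ι → ℝ, z i ∂(Measure.pi fun _ => gaussianReal 0 1) = 0 := fun i => by
    rw [integral_comp_eval (μ := fun _ : ι => gaussianReal 0 1) (f := fun x : ℝ => x)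
      aestronglyMeasurable_id, integral_id_gaussianReal]
  split_ifs with hjk
  · subst hjk
    rw [integral_comp_eval (μ := fun _ : ι => gaussianReal 0 1) (f := fun x : ℝ => x * x)
      (by fun_prop)]
    have hv := variance_fun_id_gaussianReal (μ := 0) (v := 1)
    rw [variance_eq_integral (by fun_prop), integral_id_gaussianReal] at hv
    simpa [sq] using hv
  · have hind := (iIndepFun_pi (μ := fun _ : ι => gaussianReal 0 1) (X := fun _ x => x)
      fun _ => aemeasurable_id).indepFun hjk
    rw [hind.integral_fun_mul_eq_mul_integral (measurable_pi_apply j).aestronglyMeasurable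
      (measurable_pi_apply k).aestronglyMeasurable, heval, zero_mul]

theorem dotProduct_mulVec_eq_sum {ι : Type*} [Fintype ι] (W : Matrix ι ι ℝ) (z : ι → ℝ) :
    z ⬝ᵥ W.mulVec z = ∑ j, ∑ k, W j k * (z j * z k) := by
  simp only [dotProduct, Matrix.mulVec, Finset.mul_sum]
  exact Finset.sum_congr rfl fun j _ => Finset.sum_congr rfl fun k _ => by ring

theorem memLp_quadraticForm_pi_gaussianReal {ι : Type*} [Fintype ι] (W : Matrix ι ι ℝ) :
    MemLp (fun z : ι → ℝ => z ⬝ᵥ W.mulVec z) 2 (Measure.pi fun _ => gaussianReal 0 1) := by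
  simp only [dotProduct_mulVec_eq_sum]
  exact memLp_finsetSum _ fun j _ => memLp_finsetSum _ fun k _ =>
    (memLp_eval_mul_eval_pi_gaussianReal j k).const_mul _

theorem integral_quadraticForm_pi_gaussianReal {ι : Type*} [Fintype ι] (W : Matrix ι ι ℝ) :
    ∫ z : ι → ℝ, z ⬝ᵥ W.mulVec z ∂(Measure.pi fun _ => gaussianReal 0 1) = W.trace := by
  classical
  simp only [dotProduct_mulVec_eq_sum]
  have hint : ∀ j k : ι, Integrable (fun z : ι → ℝ => W j k * (z j * z k))
      (Measure.pi fun _ => gaussianReal 0 1) := fun j k =>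
    ((memLp_eval_mul_eval_pi_gaussianReal j k).integrable one_le_two).const_mul _
  rw [integral_finsetSum _ fun j _ => integrable_finsetSum _ fun k _ => hint j k]
  refine Finset.sum_congr rfl fun j _ => ?_
  rw [integral_finsetSum _ fun k _ => hint j k]
  simp [integral_const_mul, integral_eval_mul_eval_pi_gaussianReal]

theorem mulVec_dotProduct_mulVec_mulVec {ι : Type*} [Fintype ι] (B U : Matrix ι ι ℝ)
    (z : ι → ℝ) : B.mulVec z ⬝ᵥ U.mulVec (B.mulVec z) = z ⬝ᵥ (Bᵀ * U * B).mulVec z := by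
  rw [Matrix.dotProduct_mulVec, Matrix.vecMul_mulVec, ← Matrix.dotProduct_mulVec,
    Matrix.mulVec_mulVec]

theorem measurable_quadraticForm {ι : Type*} [Fintype ι] (U : Matrix ι ι ℝ) :
    Measurable fun v : ι → ℝ => v ⬝ᵥ U.mulVec v := by
  have : Continuous fun v : ι → ℝ => v ⬝ᵥ U.mulVec v := by fun_prop
  exact this.measurable

section Moments

variable {p : ℕ} {M : Matrix (Fin p) (Fin p) ℝ}

theorem memLp_quadraticForm_gaussianPrecision (hM : M.PosDef) (U : Matrix (Fin p) (Fin p) ℝ) :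
    MemLp (fun v => v ⬝ᵥ U.mulVec v) 2 (gaussianPrecision M) := by
  obtain ⟨B, hB⟩ := exists_mul_transpose_eq_inv hM
  rw [gaussianPrecision, ← map_mulVec_pi_gaussianReal hM hB,
    memLp_map_measure_iff (measurable_quadraticForm U).aestronglyMeasurable
      (measurable_mulVec B).aemeasurable]
  simp only [Function.comp_def, mulVec_dotProduct_mulVec_mulVec]
  exact memLp_quadraticForm_pi_gaussianReal _

theorem integral_quadraticForm_gaussianPrecision (hM : M.PosDef)
    (U : Matrix (Fin p) (Fin p) ℝ) :
    ∫ v, v ⬝ᵥ U.mulVec v ∂(gaussianPrecision M) = (M⁻¹ * U).trace := by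
  obtain ⟨B, hB⟩ := exists_mul_transpose_eq_inv hM
  rw [gaussianPrecision, ← map_mulVec_pi_gaussianReal hM hB,
    integral_map (measurable_mulVec B).aemeasurable
      (measurable_quadraticForm U).aestronglyMeasurable]
  simp only [mulVec_dotProduct_mulVec_mulVec]
  rw [integral_quadraticForm_pi_gaussianReal, Matrix.trace_mul_comm, ← Matrix.mul_assoc, hB]

variable (n : ℕ)

theorem pi_gaussianPrecision (hM : M.PosDef) :
    Measure.pi (fun _ : Fin n => gaussianPrecision M) =
      volume.withDensity fun x => ENNReal.ofReal (ggmDensity n p M x) := by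
  have hint : Integrable (gaussianPrecisionDensity M) := by
    refine ⟨(measurable_gaussianPrecisionDensity M).aestronglyMeasurable, ?_⟩
    have := isProbabilityMeasure_gaussianPrecision hM
    rw [hasFiniteIntegral_iff_ofReal (ae_of_all _ (gaussianPrecisionDensity_nonneg hM))]
    have h := measure_lt_top (gaussianPrecision M) Set.univ
    rwa [gaussianPrecision, withDensity_apply _ MeasurableSet.univ, Measure.restrict_univ] at h
  simp only [ggmDensity_eq_prod hM]
  exact pi_withDensity_ofReal (fun _ : Fin n => (volume : Measure (Fin p → ℝ))) _
    (fun _ => hint) fun _ => gaussianPrecisionDensity_nonneg hM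

theorem ggmDensity_pos (hM : M.PosDef) (x : Fin n → Fin p → ℝ) : 0 < ggmDensity n p M x := by
  have := hM.det_pos
  unfold ggmDensity
  positivity

theorem measurable_ggmDensity : Measurable (ggmDensity n p M) := by
  have : Continuous (ggmDensity n p M) := by
    unfold ggmDensity
    fun_prop
  exact this.measurable

theorem integral_mul_ggmDensity (hM : M.PosDef) (g : (Fin n → Fin p → ℝ) → ℝ) :
    ∫ x, g x * ggmDensity n p M x = ∫ x, g x ∂(Measure.pi fun _ => gaussianPrecision M) := by
  rw [pi_gaussianPrecision n hM, integral_withDensity_eq_integral_toReal_smul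
    (measurable_ggmDensity n).ennreal_ofReal (ae_of_all _ fun _ => ENNReal.ofReal_lt_top)]
  simp only [ENNReal.toReal_ofReal (ggmDensity_pos n hM _).le, smul_eq_mul, mul_comm]

theorem integrable_mul_ggmDensity_iff (hM : M.PosDef) (g : (Fin n → Fin p → ℝ) → ℝ) :
    Integrable (fun x => g x * ggmDensity n p M x) ↔
      Integrable g (Measure.pi fun _ => gaussianPrecision M) := by
  rw [pi_gaussianPrecision n hM, integrable_withDensity_iff_integrable_smul'
    (measurable_ggmDensity n).ennreal_ofReal (ae_of_all _ fun _ => ENNReal.ofReal_lt_top)]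
  simp only [ENNReal.toReal_ofReal (ggmDensity_pos n hM _).le, smul_eq_mul, mul_comm]

theorem memLp_sum_quadraticForm (hM : M.PosDef) (U : Matrix (Fin p) (Fin p) ℝ) :
    MemLp (fun x : Fin n → Fin p → ℝ => ∑ i, x i ⬝ᵥ U.mulVec (x i)) 2
      (Measure.pi fun _ => gaussianPrecision M) := by
  have := isProbabilityMeasure_gaussianPrecision hM
  exact memLp_finsetSum _ fun i _ =>
    (memLp_quadraticForm_gaussianPrecision hM U).comp_measurePreserving
      (measurePreserving_eval (fun _ : Fin n => gaussianPrecision M) i)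

theorem integral_sum_quadraticForm (hM : M.PosDef) (U : Matrix (Fin p) (Fin p) ℝ) :
    ∫ x : Fin n → Fin p → ℝ, ∑ i, x i ⬝ᵥ U.mulVec (x i)
      ∂(Measure.pi fun _ => gaussianPrecision M) = n * (M⁻¹ * U).trace := by
  have := isProbabilityMeasure_gaussianPrecision hM
  have hmem := memLp_quadraticForm_gaussianPrecision hM U
  have hint : ∀ i : Fin n, Integrable (fun x : Fin n → Fin p → ℝ => x i ⬝ᵥ U.mulVec (x i))
      (Measure.pi fun _ => gaussianPrecision M) := fun i => (hmem.comp_measurePreserving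
    (measurePreserving_eval (fun _ : Fin n => gaussianPrecision M) i)).integrable one_le_two
  rw [integral_finsetSum _ fun i _ => hint i]
  have h : ∀ i : Fin n, ∫ x : Fin n → Fin p → ℝ, x i ⬝ᵥ U.mulVec (x i)
      ∂(Measure.pi fun _ => gaussianPrecision M) = (M⁻¹ * U).trace := fun i => by
    rw [integral_comp_eval (μ := fun _ : Fin n => gaussianPrecision M)
      (f := fun v => v ⬝ᵥ U.mulVec v) hmem.aestronglyMeasurable,
      integral_quadraticForm_gaussianPrecision hM]
  simp [h]

theorem variance_sum_quadraticForm (hM : M.PosDef) (U : Matrix (Fin p) (Fin p) ℝ) :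
    ∫ x : Fin n → Fin p → ℝ, (∑ i, x i ⬝ᵥ U.mulVec (x i) - n * (M⁻¹ * U).trace) ^ 2
      ∂(Measure.pi fun _ => gaussianPrecision M) =
      n * variance (fun v => v ⬝ᵥ U.mulVec v) (gaussianPrecision M) := by
  have := isProbabilityMeasure_gaussianPrecision hM
  have h := variance_sum_pi (μ := fun _ : Fin n => gaussianPrecision M)
    (X := fun _ v => v ⬝ᵥ U.mulVec v) fun _ => memLp_quadraticForm_gaussianPrecision hM U
  have hsum : (∑ i : Fin n, fun x : Fin n → Fin p → ℝ => x i ⬝ᵥ U.mulVec (x i)) =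
      fun x => ∑ i, x i ⬝ᵥ U.mulVec (x i) := by
    ext x
    simp
  rw [hsum, variance_eq_integral (memLp_sum_quadraticForm n hM U).aemeasurable,
    integral_sum_quadraticForm n hM U] at h
  simpa using h

end Moments

theorem ggmDensity_likelihoodRatio_sq_mul {n p : ℕ} {T U : Matrix (Fin p) (Fin p) ℝ}
    (hT : T.PosDef) (hTU : (T + U).PosDef) (hTU2 : (T + 2 • U).PosDef)
    (x : Fin n → Fin p → ℝ) :
    (ggmDensity n p (T + U) x / ggmDensity n p T x) ^ 2 * ggmDensity n p T x =
      (T + U).det ^ n / T.det ^ n * (T.det / (T + 2 • U).det) ^ ((n : ℝ) / 2) *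
        ggmDensity n p (T + 2 • U) x := by
  have h1 := hT.det_pos
  have h2 := hTU.det_pos
  have h3 := hTU2.det_pos
  have hpow : ∀ d : ℝ, 0 < d → d ^ n = (d ^ ((n : ℝ) / 2)) ^ 2 := fun d hd => by
    rw [← Real.rpow_mul_natCast hd.le, ← Real.rpow_natCast]
    congr 1
    push_cast
    ring
  have hexp : Real.exp (-(∑ i, x i ⬝ᵥ (T + U).mulVec (x i)) / 2) ^ 2 =
      Real.exp (-(∑ i, x i ⬝ᵥ (T + 2 • U).mulVec (x i)) / 2) *
        Real.exp (-(∑ i, x i ⬝ᵥ T.mulVec (x i)) / 2) := by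
    rw [← Real.exp_nat_mul, ← Real.exp_add]
    congr 1
    simp only [Matrix.add_mulVec, dotProduct_add, two_smul, Finset.sum_add_distrib]
    push_cast
    ring
  rw [hpow _ h1, hpow _ h2, Real.div_rpow h1.le h3.le]
  unfold ggmDensity
  rw [div_pow, mul_pow, hexp]
  have p1 := Real.rpow_pos_of_pos h1 ((n : ℝ) / 2)
  have p2 := Real.rpow_pos_of_pos h2 ((n : ℝ) / 2)
  have p3 := Real.rpow_pos_of_pos h3 ((n : ℝ) / 2)
  have p4 : 0 < (2 * Real.pi) ^ ((n * p : ℝ) / 2) := by positivity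
  field_simp

theorem natCast_mul_trace_sampleCovariance_sub {n p : ℕ} (S U : Matrix (Fin p) (Fin p) ℝ)
    (x : Fin n → Fin p → ℝ) :
    (n : ℝ) * (((n : ℝ)⁻¹ • ∑ i, vecMulVec (x i) (x i) - S) * U).trace =
      ∑ i, x i ⬝ᵥ U.mulVec (x i) - n * (S * U).trace := by
  rcases Nat.eq_zero_or_pos n with rfl | hn
  · simp
  have hn' : (n : ℝ) ≠ 0 := by positivity
  rw [Matrix.sub_mul, Matrix.trace_sub, Matrix.smul_mul, Matrix.trace_smul, Matrix.sum_mul,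
    Matrix.trace_sum, smul_eq_mul, mul_sub, mul_inv_cancel_left₀ hn']
  congr 1
  refine Finset.sum_congr rfl fun i _ => ?_
  rw [Matrix.vecMulVec_mul, Matrix.trace_vecMulVec, dotProduct_comm, ← Matrix.dotProduct_mulVec]

theorem integrable_one_add_sub_sq {Ω : Type*} [MeasurableSpace Ω] {μ : Measure Ω}
    [IsProbabilityMeasure μ] {Q : Ω → ℝ} (hQ : MemLp Q 2 μ) (c : ℝ) :
    Integrable (fun x => (1 + (Q x - c)) ^ 2) μ := by
  have h1 : MemLp (fun x => Q x - c) 2 μ := hQ.sub (memLp_const c)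
  have h2 : MemLp (fun x => 1 + (Q x - c)) 2 μ := (memLp_const (1 : ℝ)).add h1
  exact h2.integrable_sq

theorem integral_one_add_sub_sq {Ω : Type*} [MeasurableSpace Ω] {μ : Measure Ω}
    [IsProbabilityMeasure μ] {Q : Ω → ℝ} (hQ : MemLp Q 2 μ) {c : ℝ} (hc : ∫ x, Q x ∂μ = c) :
    ∫ x, (1 + (Q x - c)) ^ 2 ∂μ = 1 + ∫ x, (Q x - c) ^ 2 ∂μ := by
  have hsplit : ∀ x, (1 + (Q x - c)) ^ 2 = (1 + 2 * (Q x - c)) + (Q x - c) ^ 2 :=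
    fun x => by ring
  have hi : Integrable (fun x => Q x - c) μ :=
    (hQ.integrable one_le_two).sub (integrable_const c)
  have hsub : MemLp (fun x => Q x - c) 2 μ := hQ.sub (memLp_const c)
  have hlin : Integrable (fun x => 1 + 2 * (Q x - c)) μ :=
    (integrable_const (1 : ℝ)).add (hi.const_mul 2)
  simp only [hsplit]
  rw [integral_add hlin hsub.integrable_sq,
    integral_add (integrable_const 1) (hi.const_mul 2), integral_const_mul,
    integral_sub (hQ.integrable one_le_two) (integrable_const c), hc]
  simp

theorem integral_two_mul_one_add_sub {Ω : Type*} [MeasurableSpace Ω] {μ : Measure Ω}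
    [IsProbabilityMeasure μ] {Q : Ω → ℝ} (hQ : Integrable Q μ) (c : ℝ) :
    ∫ x, 2 * (1 + (Q x - c)) ∂μ = 2 * (1 + (∫ x, Q x ∂μ - c)) := by
  have hi : Integrable (fun x => Q x - c) μ := hQ.sub (integrable_const c)
  rw [integral_const_mul, integral_add (integrable_const 1) hi,
    integral_sub hQ (integrable_const c)]
  simp

/-- Likelihood second-moment expansion for Gaussian graphical models: for
`x₁,…,xₙ` i.i.d. `N(0, Θ₀⁻¹)`, `Σ̂` the sample covariance, and `U` symmetric with
`Θ₀ + U` and `Θ₀ + 2U` positive definite,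
`E[(p_{Θ₀+U}/p_{Θ₀} - 1 - n·tr((Σ̂-Σ₀)U))²]
  = det(Θ₀+U)^n/det(Θ₀)^n·(det Θ₀/det(Θ₀+2U))^{n/2} - 1 + Σᵢ Var(xᵢᵀUxᵢ)
    - 2n·tr(((Θ₀+U)⁻¹ - Σ₀)U)`. -/
theorem stmt13 (n p : ℕ) (S T U A : Matrix (Fin p) (Fin p) ℝ)
    (hT : T.PosDef) (hS : S = T⁻¹) (hA : A * Aᵀ = S)
    (hU : U.IsSymm) (hTU : (T + U).PosDef) (hTU2 : (T + 2 • U).PosDef) :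
    ∫ x : Fin n → Fin p → ℝ,
        (ggmDensity n p (T + U) x / ggmDensity n p T x - 1
            - (n : ℝ) *
              ((((n : ℝ)⁻¹ • ∑ i, vecMulVec (x i) (x i) - S) * U).trace)) ^ 2
          * ggmDensity n p T x
      = (T + U).det ^ (n : ℕ) / T.det ^ (n : ℕ)
          * (T.det / (T + 2 • U).det) ^ ((n : ℝ) / 2)
        - 1
        + (n : ℝ) * variance (fun v : Fin p → ℝ => v ⬝ᵥ U.mulVec v)
            ((Measure.pi fun _ : Fin p => gaussianReal 0 1).map A.mulVec)
        - 2 * (n : ℝ) * ((((T + U)⁻¹ - S) * U).trace) := by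
  have hPT := isProbabilityMeasure_gaussianPrecision hT
  have hPTU := isProbabilityMeasure_gaussianPrecision hTU
  have hPTU2 := isProbabilityMeasure_gaussianPrecision hTU2
  rw [map_mulVec_pi_gaussianReal hT (hA.trans hS), ← gaussianPrecision]
  simp only [natCast_mul_trace_sampleCovariance_sub]
  have hQT := memLp_sum_quadraticForm n hT U
  have hQTU := (memLp_sum_quadraticForm n hTU U).integrable one_le_two
  have eT := integral_sum_quadraticForm n hT U
  have eTU := integral_sum_quadraticForm n hTU U
  have eV := variance_sum_quadraticForm n hT U
  rw [← hS] at eT eV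
  generalize hc : (n : ℝ) * (S * U).trace = c at *
  generalize hQ : (fun x : Fin n → Fin p → ℝ => ∑ i, x i ⬝ᵥ U.mulVec (x i)) = Q at *
  simp only [fun x => congrFun hQ x] at *
  have hexpand : ∀ x : Fin n → Fin p → ℝ,
      (ggmDensity n p (T + U) x / ggmDensity n p T x - 1 - (Q x - c)) ^ 2 * ggmDensity n p T x =
        (T + U).det ^ n / T.det ^ n * (T.det / (T + 2 • U).det) ^ ((n : ℝ) / 2) *
          ggmDensity n p (T + 2 • U) x + (1 + (Q x - c)) ^ 2 * ggmDensity n p T x -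
          2 * (1 + (Q x - c)) * ggmDensity n p (T + U) x := fun x => by
    rw [← ggmDensity_likelihoodRatio_sq_mul hT hTU hTU2]
    have := (ggmDensity_pos n hT x).ne'
    field_simp
    ring
  generalize (T + U).det ^ n / T.det ^ n * (T.det / (T + 2 • U).det) ^ ((n : ℝ) / 2) = K
    at hexpand ⊢
  have i1 := (integrable_mul_ggmDensity_iff n hTU2 fun _ => K).mpr (integrable_const _)
  have i2 := (integrable_mul_ggmDensity_iff n hT _).mpr (integrable_one_add_sub_sq hQT c)
  have i3 := (integrable_mul_ggmDensity_iff n hTU fun x => 2 * (1 + (Q x - c))).mpr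
    (((integrable_const (1 : ℝ)).add (hQTU.sub (integrable_const c))).const_mul 2)
  have i12 : Integrable fun x => K * ggmDensity n p (T + 2 • U) x +
      (1 + (Q x - c)) ^ 2 * ggmDensity n p T x := i1.add i2
  simp only [hexpand]
  rw [integral_sub i12 i3, integral_add i1 i2,
    integral_mul_ggmDensity n hTU2 fun _ => K, integral_mul_ggmDensity n hT,
    integral_mul_ggmDensity n hTU, integral_one_add_sub_sq hQT eT,
    integral_two_mul_one_add_sub hQTU, eTU, eV, Matrix.sub_mul, Matrix.trace_sub, ← hc,
    integral_const, probReal_univ, one_smul]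
  ring
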